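/- For every n ≥ 1, the set of the first t_n terms of the LS-sequence of points equals the set of left endpoints of the n-th LS-partition: {ξ_1, ξ_2, …, ξ_{t_n}} = Λ^n_{L,S}. Consequently, D(ξ_1, …, ξ_{t_n}) = D(Λ^n_{L,S}). -/

import Mathlib

/-- The coefficient `b(i)`: `b(i) = i` if `i ≤ L−1` and `b(i) = L + (i−L)γ` if `i ≥ L`. -/
noncomputable def bcoef (L : ℕ) (γ : ℝ) (i : ℕ) : ℝ :=
  if i < L then (i : ℝ) else (L : ℝ) + ((i : ℝ) - (L : ℝ)) * γ

/-- The LS-radical inverse function `φ_{L,S}(n) = Σ_k b(a_k(n)) γ^{k+1}`, where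
`a_0(n), a_1(n), …` are the digits of `n` in base `L + S`. -/
noncomputable def phiLS (L S : ℕ) (γ : ℝ) (n : ℕ) : ℝ :=
  ∑ k ∈ Finset.range (Nat.digits (L + S) n).length,
    bcoef L γ ((Nat.digits (L + S) n).getD k 0) * γ ^ (k + 1)

/-- Membership in `ℕ_{L,S}`: the base-`(L+S)` digit string of `n` has no consecutive pair
`(a_k, a_{k+1})` in `E_{L,S} = {L,…,L+S−1} × {1,…,L+S−1}`. -/
def memNLS (L S : ℕ) (n : ℕ) : Prop :=
  (Nat.digits (L + S) n).Chain' fun a b => ¬(L ≤ a ∧ 1 ≤ b)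

/-- The set `Λⁿ_{L,S}` of left endpoints `Σ_{k=1}^n b(i_k)γᵏ` of the `n`-th LS-partition,
indexed by the admissible `n`-tuples of digits. -/
noncomputable def lamSet (L S : ℕ) (γ : ℝ) (n : ℕ) : Set ℝ :=
  {x : ℝ | ∃ i : Fin n → Fin (L + S),
    (∀ h h' : Fin n, (h' : ℕ) = (h : ℕ) + 1 → ¬(L ≤ (i h : ℕ) ∧ 1 ≤ (i h' : ℕ))) ∧
    x = ∑ k : Fin n, bcoef L γ (i k : ℕ) * γ ^ ((k : ℕ) + 1)}

/-- The discrepancy of a finite set `Q ⊂ [0,1)` of `t` points. -/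
noncomputable def discSet (Q : Set ℝ) : ℝ :=
  sSup {d : ℝ | ∃ a b : ℝ, 0 ≤ a ∧ a < b ∧ b ≤ 1 ∧
    d = |((Q ∩ Set.Ico a b).ncard : ℝ) / (Q.ncard : ℝ) - (b - a)|}

/-- The discrepancy of a finite list `(y_1, …, y_t)` of points of `[0,1)`. -/
noncomputable def discList (ys : List ℝ) : ℝ :=
  sSup {d : ℝ | ∃ a b : ℝ, 0 ≤ a ∧ a < b ∧ b ≤ 1 ∧
    d = |((ys.countP fun y => decide (a ≤ y ∧ y < b)) : ℝ) / (ys.length : ℝ) - (b - a)|}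

section LSSequence

variable {L S : ℕ} {γ : ℝ}

theorem memNLS_iff_forall_digits (hLS : 2 ≤ L + S) (n : ℕ) :
    memNLS L S n ↔ ∀ k : ℕ,
      ¬(L ≤ n / (L + S) ^ k % (L + S) ∧ 1 ≤ n / (L + S) ^ (k + 1) % (L + S)) := by
  have key : ∀ k, n / (L + S) ^ k % (L + S) = (Nat.digits (L + S) n).getD k 0 :=
    fun k => (Nat.getD_digits n k hLS).symm
  change List.IsChain _ _ ↔ _
  rw [List.isChain_iff_getElem]
  constructor
  · intro h k
    by_cases hk : k + 1 < (Nat.digits (L + S) n).length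
    · have := h k hk
      rwa [key, key, List.getD_eq_getElem _ _ hk,
        List.getD_eq_getElem _ _ (Nat.lt_of_succ_lt hk)]
    · rw [key (k + 1), List.getD_eq_default _ _ (not_lt.mp hk)]
      omega
  · intro h k hk
    have := h k
    rwa [key, key, List.getD_eq_getElem _ _ hk,
      List.getD_eq_getElem _ _ (Nat.lt_of_succ_lt hk)] at this

theorem memNLS_zero (hLS : 2 ≤ L + S) : memNLS L S 0 := by
  simp [memNLS_iff_forall_digits hLS]

theorem memNLS_iff_div (hLS : 2 ≤ L + S) (n : ℕ) :
    memNLS L S n ↔ memNLS L S (n / (L + S)) ∧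
      ¬(L ≤ n % (L + S) ∧ 1 ≤ n / (L + S) % (L + S)) := by
  have hdiv : ∀ k, n / (L + S) / (L + S) ^ k = n / (L + S) ^ (k + 1) := fun k => by
    rw [Nat.div_div_eq_div_mul, pow_succ']
  rw [memNLS_iff_forall_digits hLS, memNLS_iff_forall_digits hLS]
  simp only [hdiv]
  constructor
  · intro h
    exact ⟨fun k => h (k + 1), by simpa using h 0⟩
  · rintro ⟨h, h0⟩ (_ | k)
    · simpa using h0
    · exact h k

theorem bcoef_zero (hL : 1 ≤ L) : bcoef L γ 0 = 0 := by
  simp [bcoef, Nat.lt_of_lt_of_le Nat.zero_lt_one hL]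

theorem phiLS_eq_sum_of_lt_pow (hL : 1 ≤ L) (hLS : 2 ≤ L + S) {n N : ℕ}
    (hn : n < (L + S) ^ N) :
    phiLS L S γ n =
      ∑ k ∈ Finset.range N, bcoef L γ (n / (L + S) ^ k % (L + S)) * γ ^ (k + 1) := by
  have hlen : (Nat.digits (L + S) n).length ≤ N :=
    (Nat.digits_length_le_iff (by omega) n).mpr hn
  unfold phiLS
  rw [← Finset.sum_subset (Finset.range_mono hlen)]
  · exact Finset.sum_congr rfl fun k _ => by rw [Nat.getD_digits n k hLS]
  · intro k _ hk
    rw [← Nat.getD_digits n k hLS, List.getD_eq_default _ _ (by simpa using hk),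
      bcoef_zero hL, zero_mul]

theorem phiLS_eq_div (hL : 1 ≤ L) (hLS : 2 ≤ L + S) (n : ℕ) :
    phiLS L S γ n = bcoef L γ (n % (L + S)) * γ + γ * phiLS L S γ (n / (L + S)) := by
  have hn : n < (L + S) ^ n := Nat.lt_pow_self (by omega)
  have hn' : n < (L + S) ^ (n + 1) := hn.trans (Nat.pow_lt_pow_right (by omega) (by omega))
  have hd : n / (L + S) < (L + S) ^ n := (Nat.div_le_self _ _).trans_lt hn
  rw [phiLS_eq_sum_of_lt_pow hL hLS hn', phiLS_eq_sum_of_lt_pow hL hLS hd,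
    Finset.sum_range_succ', Finset.mul_sum, add_comm]
  congr 1
  · simp
  · refine Finset.sum_congr rfl fun k _ => ?_
    rw [Nat.div_div_eq_div_mul, ← pow_succ']
    ring

theorem phiLS_zero (hL : 1 ≤ L) (hLS : 2 ≤ L + S) : phiLS L S γ 0 = 0 := by
  rw [phiLS_eq_sum_of_lt_pow hL hLS (N := 0) (by simp)]
  simp

/-- The length of the interval of the first LS-partition indexed by the digit `d`. -/
noncomputable def lsWidth (L : ℕ) (γ : ℝ) (d : ℕ) : ℝ := if d < L then γ else γ ^ 2

theorem bcoef_mul_add_lsWidth_le (hγ0 : 0 < γ) {d e : ℕ} (hde : d < e) :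
    bcoef L γ d * γ + lsWidth L γ d ≤ bcoef L γ e * γ := by
  have h1 : (d : ℝ) + 1 ≤ e := by exact_mod_cast hde
  have h2 : 0 < γ ^ 2 := by positivity
  unfold bcoef lsWidth
  split_ifs with hd he he
  · nlinarith
  · have h3 : (d : ℝ) + 1 ≤ L := by exact_mod_cast hd
    have h4 : (L : ℝ) ≤ e := by exact_mod_cast not_lt.mp he
    nlinarith [mul_nonneg (sub_nonneg.mpr h4) h2.le]
  · omega
  · nlinarith

theorem bcoef_mul_add_lsWidth_le_one (hγ0 : 0 < γ)
    (hγeq : (L : ℝ) * γ + (S : ℝ) * γ ^ 2 = 1) {d : ℕ} (hd : d < L + S) :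
    bcoef L γ d * γ + lsWidth L γ d ≤ 1 := by
  refine (bcoef_mul_add_lsWidth_le (L := L) hγ0 hd).trans (le_of_eq ?_)
  rw [bcoef, if_neg (by omega)]
  push_cast
  linear_combination hγeq

theorem bcoef_nonneg (hγ0 : 0 < γ) (d : ℕ) : 0 ≤ bcoef L γ d := by
  unfold bcoef
  split_ifs with h
  · positivity
  · have : (L : ℝ) ≤ d := by exact_mod_cast not_lt.mp h
    have := mul_nonneg (sub_nonneg.mpr this) hγ0.le
    positivity

theorem phiLS_mem_Ico_of_div (hL : 1 ≤ L) (hLS : 2 ≤ L + S) (hγ0 : 0 < γ) {n : ℕ}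
    (hn : memNLS L S n)
    (h1 : phiLS L S γ (n / (L + S)) ∈ Set.Ico 0 1)
    (h2 : phiLS L S γ (n / (L + S) / (L + S)) ∈ Set.Ico 0 1) :
    phiLS L S γ n ∈ Set.Ico (bcoef L γ (n % (L + S)) * γ)
      (bcoef L γ (n % (L + S)) * γ + lsWidth L γ (n % (L + S))) := by
  obtain ⟨h10, h11⟩ := h1
  obtain ⟨h20, h21⟩ := h2
  rw [phiLS_eq_div hL hLS n]
  refine ⟨by nlinarith, ?_⟩
  unfold lsWidth
  split_ifs with hd
  · nlinarith
  · have h0 : n / (L + S) % (L + S) = 0 := by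
      have := ((memNLS_iff_div hLS n).mp hn).2
      omega
    rw [phiLS_eq_div hL hLS (n / (L + S)), h0, bcoef_zero hL]
    nlinarith [pow_pos hγ0 2]

theorem phiLS_mem_Ico_zero_one (hL : 1 ≤ L) (hLS : 2 ≤ L + S) (hγ0 : 0 < γ)
    (hγeq : (L : ℝ) * γ + (S : ℝ) * γ ^ 2 = 1) {n : ℕ} (hn : memNLS L S n) :
    phiLS L S γ n ∈ Set.Ico 0 1 := by
  induction n using Nat.strong_induction_on with
  | _ n ih =>
    rcases Nat.eq_zero_or_pos n with rfl | hpos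
    · simp [phiLS_zero hL hLS]
    · have hlt : n / (L + S) < n := Nat.div_lt_self hpos (by omega)
      have hm := ((memNLS_iff_div hLS n).mp hn).1
      have hm' := ((memNLS_iff_div hLS _).mp hm).1
      obtain ⟨hlo, hhi⟩ := phiLS_mem_Ico_of_div hL hLS hγ0 hn (ih _ hlt hm)
        (ih _ ((Nat.div_le_self _ _).trans_lt hlt) hm')
      exact ⟨(mul_nonneg (bcoef_nonneg hγ0 _) hγ0.le).trans hlo,
        hhi.trans_le (bcoef_mul_add_lsWidth_le_one hγ0 hγeq (Nat.mod_lt _ (by omega)))⟩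

theorem phiLS_mem_Ico (hL : 1 ≤ L) (hLS : 2 ≤ L + S) (hγ0 : 0 < γ)
    (hγeq : (L : ℝ) * γ + (S : ℝ) * γ ^ 2 = 1) {n : ℕ} (hn : memNLS L S n) :
    phiLS L S γ n ∈ Set.Ico (bcoef L γ (n % (L + S)) * γ)
      (bcoef L γ (n % (L + S)) * γ + lsWidth L γ (n % (L + S))) := by
  have hm := ((memNLS_iff_div hLS n).mp hn).1
  exact phiLS_mem_Ico_of_div hL hLS hγ0 hn (phiLS_mem_Ico_zero_one hL hLS hγ0 hγeq hm)
    (phiLS_mem_Ico_zero_one hL hLS hγ0 hγeq ((memNLS_iff_div hLS _).mp hm).1)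

theorem phiLS_injOn (hL : 1 ≤ L) (hLS : 2 ≤ L + S) (hγ0 : 0 < γ)
    (hγeq : (L : ℝ) * γ + (S : ℝ) * γ ^ 2 = 1) :
    Set.InjOn (phiLS L S γ) {n | memNLS L S n} := by
  have main : ∀ N m n : ℕ, m < (L + S) ^ N → n < (L + S) ^ N → memNLS L S m →
      memNLS L S n → phiLS L S γ m = phiLS L S γ n → m = n := by
    intro N
    induction N with
    | zero => intro m n hm hn _ _ _; simp at hm hn; omega
    | succ N ih =>
      intro m n hm hn hm' hn' heq
      obtain ⟨hml, hmu⟩ := phiLS_mem_Ico hL hLS hγ0 hγeq hm'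
      obtain ⟨hnl, hnu⟩ := phiLS_mem_Ico hL hLS hγ0 hγeq hn'
      have hmod : m % (L + S) = n % (L + S) := by
        rcases lt_trichotomy (m % (L + S)) (n % (L + S)) with h | h | h
        · have := bcoef_mul_add_lsWidth_le (L := L) hγ0 h
          linarith
        · exact h
        · have := bcoef_mul_add_lsWidth_le (L := L) hγ0 h
          linarith
      have hdiv : m / (L + S) = n / (L + S) := by
        apply ih
        · exact Nat.div_lt_of_lt_mul (by rwa [← pow_succ'])
        · exact Nat.div_lt_of_lt_mul (by rwa [← pow_succ'])
        · exact ((memNLS_iff_div hLS _).mp hm').1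
        · exact ((memNLS_iff_div hLS _).mp hn').1
        · rw [phiLS_eq_div hL hLS m, phiLS_eq_div hL hLS n, hmod] at heq
          exact mul_left_cancel₀ hγ0.ne' (add_left_cancel heq)
      rw [← Nat.div_add_mod m (L + S), ← Nat.div_add_mod n (L + S), hmod, hdiv]
  intro m hm n hn heq
  have hB : 1 < L + S := by omega
  exact main (m + n) m n
    ((Nat.lt_pow_self hB).trans_le (Nat.pow_le_pow_right (by omega) (by omega)))
    ((Nat.lt_pow_self hB).trans_le (Nat.pow_le_pow_right (by omega) (by omega))) hm hn heq

theorem lamSet_eq_image (hL : 1 ≤ L) (hLS : 2 ≤ L + S) (n : ℕ) :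
    lamSet L S γ n = phiLS L S γ '' {m | m < (L + S) ^ n ∧ memNLS L S m} := by
  have hsum : ∀ m : Fin ((L + S) ^ n), phiLS L S γ m =
      ∑ k : Fin n, bcoef L γ (finFunctionFinEquiv.symm m k : ℕ) * γ ^ ((k : ℕ) + 1) := by
    intro m
    rw [phiLS_eq_sum_of_lt_pow hL hLS m.2, Finset.sum_range]
    simp only [finFunctionFinEquiv_symm_apply_val]
  have hmem : ∀ m : Fin ((L + S) ^ n), memNLS L S m ↔
      ∀ h h' : Fin n, (h' : ℕ) = (h : ℕ) + 1 →
        ¬(L ≤ (finFunctionFinEquiv.symm m h : ℕ) ∧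
          1 ≤ (finFunctionFinEquiv.symm m h' : ℕ)) := by
    intro m
    rw [memNLS_iff_forall_digits hLS]
    simp only [finFunctionFinEquiv_symm_apply_val]
    constructor
    · intro h k k' hk
      rw [hk]
      exact h k
    · intro h k
      by_cases hk : k + 1 < n
      · exact h ⟨k, by omega⟩ ⟨k + 1, hk⟩ rfl
      · have : (m : ℕ) / (L + S) ^ (k + 1) = 0 := Nat.div_eq_of_lt
          (m.2.trans_le (Nat.pow_le_pow_right (by omega) (by omega)))
        simp [this]
  ext x
  constructor
  · rintro ⟨i, hi, rfl⟩
    refine ⟨finFunctionFinEquiv i, ⟨(finFunctionFinEquiv i).2, (hmem _).mpr ?_⟩, ?_⟩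
    · simpa using hi
    · rw [hsum, Equiv.symm_apply_apply]
  · rintro ⟨m, ⟨hlt, hm⟩, rfl⟩
    exact ⟨finFunctionFinEquiv.symm ⟨m, hlt⟩, (hmem ⟨m, hlt⟩).mp hm, hsum ⟨m, hlt⟩⟩

open Classical in
theorem card_memNLS_mod_eq (hLS : 2 ≤ L + S) (n : ℕ) {d : ℕ} (hd : d < L + S) :
    (((Finset.range ((L + S) ^ (n + 1))).filter (memNLS L S)).filter
        fun m => m % (L + S) = d).card =
      (((Finset.range ((L + S) ^ n)).filter (memNLS L S)).filter
        fun m => ¬(L ≤ d ∧ 1 ≤ m % (L + S))).card := by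
  have hB : 0 < L + S := by omega
  have hmod : ∀ m, ((L + S) * m + d) % (L + S) = d := fun m => by
    rw [Nat.mul_add_mod, Nat.mod_eq_of_lt hd]
  have hdiv : ∀ m, ((L + S) * m + d) / (L + S) = m := fun m => by
    rw [Nat.mul_add_div hB, Nat.div_eq_of_lt hd, add_zero]
  refine Finset.card_nbij' (fun m => m / (L + S)) (fun m => (L + S) * m + d) ?_ ?_ ?_ ?_
  · intro m hm
    simp only [Finset.coe_filter, Finset.mem_filter, Finset.mem_range, Set.mem_ofPred_eq] at hm ⊢
    obtain ⟨⟨hlt, hm⟩, rfl⟩ := hm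
    have h := (memNLS_iff_div hLS m).mp hm
    exact ⟨⟨Nat.div_lt_of_lt_mul (by rwa [← pow_succ']), h.1⟩, h.2⟩
  · intro m hm
    simp only [Finset.coe_filter, Finset.mem_filter, Finset.mem_range, Set.mem_ofPred_eq] at hm ⊢
    obtain ⟨⟨hlt, hm⟩, hne⟩ := hm
    refine ⟨⟨?_, ?_⟩, hmod m⟩
    · rw [pow_succ']
      calc (L + S) * m + d < (L + S) * (m + 1) := by rw [mul_add]; omega
        _ ≤ (L + S) * (L + S) ^ n := Nat.mul_le_mul_left _ hlt
    · rw [memNLS_iff_div hLS, hmod, hdiv]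
      exact ⟨hm, hne⟩
  · intro m hm
    simp only [Finset.coe_filter, Finset.mem_filter, Set.mem_ofPred_eq] at hm
    simp only [← hm.2, Nat.div_add_mod]
  · intro m _
    exact hdiv m

open Classical in
theorem card_memNLS_lt_pow (hL : 1 ≤ L) (hLS : 2 ≤ L + S) {t : ℕ → ℕ} (ht0 : t 0 = 1)
    (ht1 : t 1 = L + S) (htrec : ∀ n : ℕ, t (n + 2) = L * t (n + 1) + S * t n) (n : ℕ) :
    ((Finset.range ((L + S) ^ n)).filter (memNLS L S)).card = t n := by
  have hlow : ∀ n d, d < L →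
      (((Finset.range ((L + S) ^ (n + 1))).filter (memNLS L S)).filter
        fun m => m % (L + S) = d).card =
      ((Finset.range ((L + S) ^ n)).filter (memNLS L S)).card := by
    intro n d hd
    rw [card_memNLS_mod_eq hLS n (by omega),
      Finset.filter_true_of_mem fun m _ => by omega]
  induction n using Nat.twoStepInduction with
  | zero =>
    rw [ht0, Finset.filter_true_of_mem]
    · simp
    · intro m hm
      have : m = 0 := by simpa using hm
      exact this ▸ memNLS_zero hLS
  | one =>
    rw [ht1, Finset.filter_true_of_mem]
    · simp
    · intro m hm
      have hm : m < L + S := by simpa using hm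
      rw [memNLS_iff_div hLS, Nat.div_eq_of_lt hm]
      simp [memNLS_zero hLS]
  | more n ih0 ih1 =>
    have hhigh : ∀ d, L ≤ d → d < L + S →
        (((Finset.range ((L + S) ^ (n + 1 + 1))).filter (memNLS L S)).filter
          fun m => m % (L + S) = d).card = t n := by
      intro d hd hd'
      rw [card_memNLS_mod_eq hLS _ hd', ← ih0, ← hlow n 0 (by omega)]
      congr 1
      refine Finset.filter_congr fun m _ => ?_
      omega
    rw [Finset.card_eq_sum_card_fiberwise (f := fun m => m % (L + S))
        (t := Finset.range (L + S)) fun m _ => by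
          simpa using Nat.mod_lt m (by omega : 0 < L + S),
      Finset.sum_range_add,
      Finset.sum_congr rfl fun d hd => (hlow (n + 1) d (by simpa using hd)).trans ih1,
      Finset.sum_congr rfl fun d hd => hhigh (L + d) (by omega)
        (by simpa using hd), htrec]
    simp

/-- The first `Nat.count p N` values of `Nat.nth p` are exactly the numbers below `N`
satisfying `p`. -/
theorem nth_image_Iio_count (p : ℕ → Prop) [DecidablePred p] (N : ℕ) :
    Nat.nth p '' Set.Iio (Nat.count p N) = {m | m < N ∧ p m} := by
  ext m
  constructor
  · rintro ⟨j, hj, rfl⟩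
    exact ⟨Nat.nth_lt_of_lt_count hj,
      Nat.nth_mem j fun hf => lt_of_lt_of_le hj (Nat.count_le_card hf N)⟩
  · rintro ⟨hlt, hm⟩
    exact ⟨Nat.count p m, Nat.count_strict_mono hm hlt, Nat.nth_count hm⟩

theorem nth_injOn_Iio_count (p : ℕ → Prop) [DecidablePred p] (N : ℕ) :
    Set.InjOn (Nat.nth p) (Set.Iio (Nat.count p N)) := by
  have h : ∀ j ∈ Set.Iio (Nat.count p N), Nat.count p (Nat.nth p j) = j := fun j hj =>
    Nat.count_nth fun hf => lt_of_lt_of_le hj (Nat.count_le_card hf N)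
  intro i hi j hj hij
  rw [← h i hi, ← h j hj, hij]

end LSSequence

theorem discList_eq_discSet_of_nodup {l : List ℝ} (hl : l.Nodup) :
    discList l = discSet {x | x ∈ l} := by
  classical
  have hlen : ({x | x ∈ l} : Set ℝ).ncard = l.length := by
    rw [← List.toFinset_card_of_nodup hl, ← Set.ncard_coe_finset, List.coe_toFinset]
  have hcount : ∀ a b : ℝ, ({x | x ∈ l} ∩ Set.Ico a b : Set ℝ).ncard =
      l.countP fun y => decide (a ≤ y ∧ y < b) := by
    intro a b
    rw [List.countP_eq_length_filter, ← List.toFinset_card_of_nodup (hl.filter _),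
      ← Set.ncard_coe_finset, List.coe_toFinset]
    congr 1
    ext x
    simp
  unfold discList discSet
  simp only [hlen, hcount]

/-- For every `n ≥ 1` (here `n+1`), the set of the first `tₙ` terms of
the LS-sequence of points `ξ_N = φ_{L,S}(m_N)` (with `m_1 < m_2 < ⋯` the increasing
enumeration of `ℕ_{L,S}`) equals the set `Λⁿ_{L,S}` of left endpoints of the `n`-th
LS-partition; consequently `D(ξ_1, …, ξ_{tₙ}) = D(Λⁿ_{L,S})`. -/
theorem stmt_19 (L S : ℕ) (hL : 1 ≤ L) (hLS : 2 ≤ L + S)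
    (γ : ℝ) (hγ0 : 0 < γ) (hγ1 : γ < 1)
    (hγeq : (L : ℝ) * γ + (S : ℝ) * γ ^ 2 = 1)
    (t : ℕ → ℕ) (ht0 : t 0 = 1) (ht1 : t 1 = L + S)
    (htrec : ∀ n : ℕ, t (n + 2) = L * t (n + 1) + S * t n) :
    ∀ n : ℕ,
      {x : ℝ | ∃ j < t (n + 1), x = phiLS L S γ (Nat.nth (memNLS L S) j)}
        = lamSet L S γ (n + 1) ∧
      discList ((List.range (t (n + 1))).map fun j =>
          phiLS L S γ (Nat.nth (memNLS L S) j))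
        = discSet (lamSet L S γ (n + 1)) := by
  classical
  intro n
  have hcount : Nat.count (memNLS L S) ((L + S) ^ (n + 1)) = t (n + 1) := by
    rw [Nat.count_eq_card_filter_range, ← card_memNLS_lt_pow hL hLS ht0 ht1 htrec (n + 1)]
  have himage := nth_image_Iio_count (memNLS L S) ((L + S) ^ (n + 1))
  have hinj := nth_injOn_Iio_count (memNLS L S) ((L + S) ^ (n + 1))
  rw [hcount] at himage hinj
  have hset : {x : ℝ | ∃ j < t (n + 1), x = phiLS L S γ (Nat.nth (memNLS L S) j)}
      = lamSet L S γ (n + 1) := by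
    rw [lamSet_eq_image hL hLS, ← himage, Set.image_image]
    ext x
    simp [eq_comm]
  refine ⟨hset, ?_⟩
  have hmaps : Set.MapsTo (Nat.nth (memNLS L S)) (Set.Iio (t (n + 1))) {m | memNLS L S m} :=
    fun j hj => (himage.subset (Set.mem_image_of_mem _ hj)).2
  rw [discList_eq_discSet_of_nodup, ← hset]
  · congr 1
    ext x
    simp [eq_comm]
  · refine List.Nodup.map_on (fun i hi j hj hij => ?_) List.nodup_range
    exact ((phiLS_injOn hL hLS hγ0 hγeq).comp hinj hmaps)
      (by simpa using hi) (by simpa using hj) hij
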